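/- arXiv:1104.1144 — 2 statements merged into one kernel-verified Lean document; each statement's English description precedes it below -/
import Mathlib

section
/- Let f : {density matrices in M_d(ℂ)} → [0,∞) satisfy (E1) unitary invariance: f(UρU†) = f(ρ) for every unitary U ∈ M_d(ℂ), and (E2) concavity: f(tρ₁ + (1−t)ρ₂) ≥ t f(ρ₁) + (1−t) f(ρ₂) for all t ∈ [0,1]. Define F_pure(ψ) = f(Diag(λ(ψ))), where Diag(λ(ψ)) is the diagonal density matrix with entries |ψ_n|². Then F_pure is a pure-state ensemble monotone under U(1)-invariant operations: for every unit vector ψ ∈ ℂ^d and every U(1)-invariant pure-state ensemble operation {K_x}, F_pure(ψ) ≥ Σ_{x : p_x>0} p_x F_pure(K_xψ/‖K_xψ‖), where p_x = ‖K_xψ‖². -/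
open Matrix Finset
open scoped ComplexOrder

noncomputable section

/-- Squared Euclidean norm of a vector in `ℂ^d`. -/
def nsq {d : ℕ} (ψ : Fin d → ℂ) : ℝ := ∑ n, ‖ψ n‖ ^ 2

/-- The rank-one projector `|ψ⟩⟨ψ|`, with entries `ψ m * conj (ψ n)`. -/
def pureProj {d : ℕ} (ψ : Fin d → ℂ) : Matrix (Fin d) (Fin d) ℂ :=
  Matrix.vecMulVec ψ (star ψ)

/-- A density matrix: positive semidefinite with trace one. -/
def IsDensityMatrix {d : ℕ} (ρ : Matrix (Fin d) (Fin d) ℂ) : Prop :=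
  ρ.PosSemidef ∧ ρ.trace = 1

/-- Convex-roof extension of a function defined on pure states (unit vectors). -/
def convexRoof {d : ℕ} (Fpure : (Fin d → ℂ) → ℝ) (ρ : Matrix (Fin d) (Fin d) ℂ) : ℝ :=
  sInf { r : ℝ | ∃ (m : ℕ) (q : Fin m → ℝ) (ψ : Fin m → Fin d → ℂ),
    (∀ i, 0 ≤ q i) ∧ (∑ i, q i = 1) ∧ (∀ i, nsq (ψ i) = 1) ∧
    ρ = ∑ i, q i • pureProj (ψ i) ∧ r = ∑ i, q i * Fpure (ψ i) }

/-- A number-shift Kraus operator: for some `ℓ : ℤ`, `K m n = 0` unless `m = n + ℓ`. -/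
def IsNumberShift {d : ℕ} (K : Matrix (Fin d) (Fin d) ℂ) : Prop :=
  ∃ ℓ : ℤ, ∀ m n : Fin d, (m : ℤ) ≠ (n : ℤ) + ℓ → K m n = 0

/-- `Fpure` is a pure-state ensemble monotone under U(1)-invariant operations:
for every unit vector `ψ` and every finite family of number-shift Kraus operators
`{K x}` with `∑ x, (K x)ᴴ * K x = 1`, the average of `Fpure` over the (normalized)
outcomes with positive probability does not exceed `Fpure ψ`. -/
def IsPureEnsembleMonotone {d : ℕ} (Fpure : (Fin d → ℂ) → ℝ) : Prop :=
  ∀ (ψ : Fin d → ℂ), nsq ψ = 1 →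
    ∀ (m : ℕ) (K : Fin m → Matrix (Fin d) (Fin d) ℂ),
      (∀ x, IsNumberShift (K x)) →
      (∑ x, (K x)ᴴ * K x = 1) →
      Fpure ψ ≥
        ∑ x ∈ Finset.univ.filter (fun x => 0 < nsq ((K x).mulVec ψ)),
          nsq ((K x).mulVec ψ) *
            Fpure ((Real.sqrt (nsq ((K x).mulVec ψ)))⁻¹ • (K x).mulVec ψ)

/-- The diagonal density matrix with entries `|ψ_n|²` (the twirl of `|ψ⟩⟨ψ|`). -/
def diagOf {d : ℕ} (ψ : Fin d → ℂ) : Matrix (Fin d) (Fin d) ℂ :=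
  Matrix.diagonal fun n => ((‖ψ n‖ ^ 2 : ℝ) : ℂ)

/-- A number-shift Kraus operator is supported on the graph of a permutation. -/
lemma IsNumberShift.exists_perm {d : ℕ} {K : Matrix (Fin d) (Fin d) ℂ} (hK : IsNumberShift K) :
    ∃ π : Equiv.Perm (Fin d), ∀ m n, m ≠ π n → K m n = 0 := by
  obtain ⟨l, hl⟩ := hK
  let s : Set (Fin d) := {n | 0 ≤ (n : ℤ) + l ∧ (n : ℤ) + l < d}
  let g : Fin d → Fin d := fun n =>
    if h : 0 ≤ (n : ℤ) + l ∧ (n : ℤ) + l < d then ⟨((n : ℤ) + l).toNat, by omega⟩ else n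
  have hg : ∀ n ∈ s, ((g n : ℕ) : ℤ) = n + l := by
    intro n hn
    have hn' : 0 ≤ (n : ℤ) + l ∧ (n : ℤ) + l < d := hn
    simp only [g, dif_pos hn']
    omega
  have hinj : Set.InjOn g s := by
    intro a ha b hb hab
    have h₁ := hg a ha
    have h₂ := hg b hb
    rw [hab] at h₁
    apply Fin.ext
    omega
  obtain ⟨e, he⟩ := Set.MapsTo.exists_equiv_extend_of_card_eq (t := Finset.univ)
    (by simp) (f := g) (s := s) (fun _ _ => by simp) hinj
  refine ⟨e.trans (Equiv.subtypeUnivEquiv fun x => Finset.mem_univ x), fun m n hmn => ?_⟩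
  apply hl
  intro h
  have hn : n ∈ s := ⟨by omega, by have := m.2; omega⟩
  apply hmn
  have h₁ := hg n hn
  rw [← he n hn] at h₁
  apply Fin.ext
  simp only [Equiv.trans_apply, Equiv.subtypeUnivEquiv_apply]
  omega

/-- The diagonal matrix of a probability vector is a density matrix. -/
lemma isDensityMatrix_diagonal {d : ℕ} {a : Fin d → ℝ} (ha : a ∈ stdSimplex ℝ (Fin d)) :
    IsDensityMatrix (Matrix.diagonal fun n => (a n : ℂ)) := by
  refine ⟨Matrix.PosSemidef.diagonal fun n => ?_, ?_⟩
  · simpa using ha.1 n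
  · rw [Matrix.trace_diagonal]
    exact_mod_cast ha.2

/-- The squared moduli of the components of a unit vector form a probability vector. -/
lemma normSq_mem_stdSimplex {d : ℕ} {ψ : Fin d → ℂ} (hψ : nsq ψ = 1) :
    (fun n => ‖ψ n‖ ^ 2) ∈ stdSimplex ℝ (Fin d) :=
  ⟨fun _ => by positivity, hψ⟩

/-- A unitarily invariant function takes the same value on diagonal density matrices
whose entries agree up to a permutation. -/
lemma map_diagonal_comp_perm {d : ℕ} {f : Matrix (Fin d) (Fin d) ℂ → ℝ}
    (hf : ∀ ρ, IsDensityMatrix ρ → ∀ U ∈ Matrix.unitaryGroup (Fin d) ℂ, f (U * ρ * Uᴴ) = f ρ)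
    {a : Fin d → ℝ} (ha : a ∈ stdSimplex ℝ (Fin d)) (π : Equiv.Perm (Fin d)) :
    f (Matrix.diagonal fun n => (a (π n) : ℂ)) = f (Matrix.diagonal fun n => (a n : ℂ)) := by
  have hH : ((1 : Matrix (Fin d) (Fin d) ℂ).submatrix π id)ᴴ =
      (1 : Matrix (Fin d) (Fin d) ℂ).submatrix id π := by
    rw [Matrix.conjTranspose_submatrix, Matrix.conjTranspose_one]
  have hU : (1 : Matrix (Fin d) (Fin d) ℂ).submatrix π id ∈ Matrix.unitaryGroup (Fin d) ℂ := by
    rw [Matrix.mem_unitaryGroup_iff, Matrix.star_eq_conjTranspose, hH,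
      ← Matrix.submatrix_mul _ _ _ _ _ Function.bijective_id, mul_one,
      Matrix.submatrix_one _ π.injective]
  rw [← hf _ (isDensityMatrix_diagonal ha) _ hU, hH]
  congr 1
  ext i j
  rcases eq_or_ne i j with rfl | hij
  · simp [Matrix.mul_apply, Matrix.diagonal_apply, Matrix.one_apply]
  · simp [Matrix.mul_apply, Matrix.diagonal_apply, Matrix.one_apply, hij]

/-- A concave function of density matrices restricts to a concave function of
probability vectors. -/
lemma concaveOn_diagonal {d : ℕ} {f : Matrix (Fin d) (Fin d) ℂ → ℝ}
    (hf : ∀ ρ₁ ρ₂, IsDensityMatrix ρ₁ → IsDensityMatrix ρ₂ → ∀ t : ℝ, 0 ≤ t → t ≤ 1 →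
      t * f ρ₁ + (1 - t) * f ρ₂ ≤ f (t • ρ₁ + (1 - t) • ρ₂)) :
    ConcaveOn ℝ (stdSimplex ℝ (Fin d))
      (fun a => f (Matrix.diagonal fun n => (a n : ℂ))) := by
  refine ⟨convex_stdSimplex ℝ _, fun a ha b hb s t hs ht hst => ?_⟩
  obtain rfl : t = 1 - s := by linarith
  refine (hf _ _ (isDensityMatrix_diagonal ha) (isDensityMatrix_diagonal hb) s hs
    (by linarith)).trans_eq ?_
  rw [← Matrix.diagonal_smul, ← Matrix.diagonal_smul, Matrix.diagonal_add]
  congr 2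
  ext n
  simp

lemma nsq_nonneg {d : ℕ} (ψ : Fin d → ℂ) : 0 ≤ nsq ψ :=
  Finset.sum_nonneg fun _ _ => by positivity

lemma normSq_normalize {d : ℕ} (v : Fin d → ℂ) (n : Fin d) :
    ‖((Real.sqrt (nsq v))⁻¹ • v) n‖ ^ 2 = (nsq v)⁻¹ * ‖v n‖ ^ 2 := by
  rw [Pi.smul_apply, norm_smul, mul_pow, norm_inv, inv_pow, Real.norm_eq_abs, sq_abs,
    Real.sq_sqrt (nsq_nonneg v)]

lemma nsq_normalize {d : ℕ} {v : Fin d → ℂ} (hv : 0 < nsq v) :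
    nsq ((Real.sqrt (nsq v))⁻¹ • v) = 1 := by
  rw [nsq]
  simp only [normSq_normalize]
  rw [← Finset.mul_sum]
  exact inv_mul_cancel₀ hv.ne'

lemma normSq_mulVec_perm {d : ℕ} {K : Matrix (Fin d) (Fin d) ℂ} {π : Equiv.Perm (Fin d)}
    (hK : ∀ m n, m ≠ π n → K m n = 0) (ψ : Fin d → ℂ) (n : Fin d) :
    ‖K.mulVec ψ (π n)‖ ^ 2 = (Kᴴ * K) n n * ‖ψ n‖ ^ 2 := by
  have h₁ : K.mulVec ψ (π n) = K (π n) n * ψ n := by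
    rw [Matrix.mulVec, dotProduct]
    refine Finset.sum_eq_single n (fun j _ hj => ?_) (by simp)
    rw [hK _ _ fun h => hj (π.injective h).symm, zero_mul]
  have h₂ : (Kᴴ * K) n n = (‖K (π n) n‖ : ℂ) ^ 2 := by
    rw [Matrix.mul_apply, Finset.sum_eq_single (π n)]
    · rw [Matrix.conjTranspose_apply]
      exact RCLike.conj_mul _
    · intro j _ hj
      rw [hK _ _ hj, mul_zero]
    · simp
  rw [h₁, h₂, norm_mul]
  push_cast
  ring

/-- Up to permutations, the unnormalized outcome distributions of a complete family of
operators, each supported on the graph of a permutation, add up to the input distribution. -/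
lemma sum_normSq_mulVec_perm {d m : ℕ} {K : Fin m → Matrix (Fin d) (Fin d) ℂ}
    {π : Fin m → Equiv.Perm (Fin d)} (hπ : ∀ x i j, i ≠ π x j → K x i j = 0)
    (hK : ∑ x, (K x)ᴴ * K x = 1) (ψ : Fin d → ℂ) (n : Fin d) :
    ∑ x, ‖(K x).mulVec ψ (π x n)‖ ^ 2 = ‖ψ n‖ ^ 2 := by
  have h := congrFun (congrFun hK n) n
  rw [Matrix.sum_apply, Matrix.one_apply_eq] at h
  have h' : ((∑ x, ‖(K x).mulVec ψ (π x n)‖ ^ 2 : ℝ) : ℂ) = (‖ψ n‖ ^ 2 : ℝ) := by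
    push_cast
    rw [Finset.sum_congr rfl fun x _ => normSq_mulVec_perm (hπ x) ψ n, ← Finset.sum_mul, h,
      one_mul]
  exact_mod_cast h'

/-- if `f` is unitarily invariant (E1) and concave (E2) on density matrices,
then `ψ ↦ f(Diag(λ(ψ)))` is a pure-state ensemble monotone under U(1)-invariant
operations. -/
theorem stmt_2 {d : ℕ} (hd : 1 ≤ d) (f : Matrix (Fin d) (Fin d) ℂ → ℝ)
    (hf0 : ∀ ρ, IsDensityMatrix ρ → 0 ≤ f ρ)
    (hE1 : ∀ ρ, IsDensityMatrix ρ → ∀ U ∈ Matrix.unitaryGroup (Fin d) ℂ,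
      f (U * ρ * Uᴴ) = f ρ)
    (hE2 : ∀ ρ₁ ρ₂, IsDensityMatrix ρ₁ → IsDensityMatrix ρ₂ →
      ∀ t : ℝ, 0 ≤ t → t ≤ 1 →
        t * f ρ₁ + (1 - t) * f ρ₂ ≤ f (t • ρ₁ + (1 - t) • ρ₂)) :
    IsPureEnsembleMonotone (fun ψ => f (diagOf ψ)) := by
  intro ψ hψ m K hshift hK
  choose π hπ using fun x => (hshift x).exists_perm
  have hsum := sum_normSq_mulVec_perm hπ hK ψ
  let S : Finset (Fin m) := Finset.univ.filter fun x => 0 < nsq ((K x).mulVec ψ)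
  let a : Fin m → Fin d → ℝ := fun x n =>
    ‖((Real.sqrt (nsq ((K x).mulVec ψ)))⁻¹ • (K x).mulVec ψ) n‖ ^ 2
  have hpos : ∀ x ∈ S, 0 < nsq ((K x).mulVec ψ) := fun x hx => (Finset.mem_filter.mp hx).2
  have ha : ∀ x ∈ S, a x ∈ stdSimplex ℝ (Fin d) := fun x hx =>
    normSq_mem_stdSimplex (nsq_normalize (hpos x hx))
  have haπ : ∀ x ∈ S, (fun n => a x (π x n)) ∈ stdSimplex ℝ (Fin d) := fun x hx =>
    ⟨fun n => (ha x hx).1 _, (Equiv.sum_comp (π x) (a x)).trans (ha x hx).2⟩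
  have hzero : ∀ x ∉ S, nsq ((K x).mulVec ψ) = 0 := fun x hx =>
    le_antisymm (not_lt.mp fun h => hx (Finset.mem_filter.mpr ⟨Finset.mem_univ x, h⟩))
      (nsq_nonneg _)
  have hp : ∑ x ∈ S, nsq ((K x).mulVec ψ) = 1 := by
    rw [Finset.sum_subset (Finset.subset_univ S) fun x _ hx => hzero x hx, ← hψ, nsq,
      ← Finset.sum_congr rfl fun n _ => hsum n, Finset.sum_comm]
    exact Finset.sum_congr rfl fun x _ =>
      (Equiv.sum_comp (π x) fun n => ‖(K x).mulVec ψ n‖ ^ 2).symm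
  have hmix : ∑ x ∈ S, nsq ((K x).mulVec ψ) • (fun n => a x (π x n)) =
      fun n => ‖ψ n‖ ^ 2 := by
    ext n
    rw [Finset.sum_apply, ← hsum n, ← Finset.sum_subset (Finset.subset_univ S)]
    · refine Finset.sum_congr rfl fun x hx => ?_
      simp only [Pi.smul_apply, smul_eq_mul, a]
      rw [← Pi.smul_apply, normSq_normalize, mul_inv_cancel_left₀ (hpos x hx).ne']
    · intro x _ hx
      exact (Finset.sum_eq_zero_iff_of_nonneg fun _ _ => by positivity).mp (hzero x hx) _
        (Finset.mem_univ _)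
  have hJ := (concaveOn_diagonal hE2).le_map_sum (fun x _ => nsq_nonneg _) hp haπ
  rw [hmix] at hJ
  refine le_trans (le_of_eq (Finset.sum_congr rfl fun x hx => ?_)) hJ
  rw [smul_eq_mul, map_diagonal_comp_perm hE1 (ha x hx) (π x)]
  rfl
end
end

section
/- Let α ∈ ℝ, p ∈ [0,1], φ₁ = (cos(α/2), sin(α/2)), φ₂ = (−sin(α/2), cos(α/2)) ∈ ℂ², and ρ = p|φ₁⟩⟨φ₁| + (1−p)|φ₂⟩⟨φ₂|. Then the U(1)-frameness of formation of ρ is V(ρ) = (1−2p)²·sin²α. -/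
open Matrix Finset
open scoped ComplexOrder

noncomputable section

/-- The flip (Pauli X) operator on a qubit. -/
def Xmat : Matrix (Fin 2) (Fin 2) ℂ := !![0, 1; 1, 0]

/-- `ρ̃ = X ρ* X`, with `ρ*` the entrywise complex conjugate of `ρ`. -/
def rhoTilde (ρ : Matrix (Fin 2) (Fin 2) ℂ) : Matrix (Fin 2) (Fin 2) ℂ :=
  Xmat * ρ.map (starRingEnd ℂ) * Xmat

/-- The concurrence of a qubit pure state, `C₂(ψ) = 2|ψ₀||ψ₁|`. -/
def Cpure (ψ : Fin 2 → ℂ) : ℝ := 2 * ‖ψ 0‖ * ‖ψ 1‖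

/-- The pure state `φ₁ = (cos(α/2), sin(α/2))`. -/
def phi1 (α : ℝ) : Fin 2 → ℂ := ![((Real.cos (α / 2) : ℝ) : ℂ), ((Real.sin (α / 2) : ℝ) : ℂ)]

/-- The pure state `φ₂ = (−sin(α/2), cos(α/2))`. -/
def phi2 (α : ℝ) : Fin 2 → ℂ := ![(-(Real.sin (α / 2) : ℝ) : ℂ), ((Real.cos (α / 2) : ℝ) : ℂ)]

/-- The qubit state `ρ = p|φ₁⟩⟨φ₁| + (1−p)|φ₂⟩⟨φ₂|`. -/
def rhoAlpha (α p : ℝ) : Matrix (Fin 2) (Fin 2) ℂ :=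
  p • pureProj (phi1 α) + (1 - p) • pureProj (phi2 α)

/-- The pure-state number variance on a qubit,
`V_pure(ψ) = 4(⟨ψ|n̂²|ψ⟩ − ⟨ψ|n̂|ψ⟩²)` with `n̂ = diag(0,1)`;
for unit vectors this equals `4|ψ₀|²|ψ₁|²`. -/
def Vpure (ψ : Fin 2 → ℂ) : ℝ :=
  4 * ((∑ n : Fin 2, ((n : ℕ) : ℝ) ^ 2 * ‖ψ n‖ ^ 2)
    - (∑ n : Fin 2, ((n : ℕ) : ℝ) * ‖ψ n‖ ^ 2) ^ 2)

/-- On unit vectors the pure-state number variance is `4 |ψ₀ ψ₁*|²`. -/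
lemma Vpure_eq_of_nsq_eq_one {ψ : Fin 2 → ℂ} (h : nsq ψ = 1) :
    Vpure ψ = 4 * ‖pureProj ψ 0 1‖ ^ 2 := by
  simp only [nsq, Fin.sum_univ_two] at h
  simp only [Vpure, pureProj, Fin.sum_univ_two, vecMulVec_apply, Pi.star_apply, norm_mul,
    norm_star, mul_pow, Fin.val_zero, Fin.val_one, Nat.cast_zero, Nat.cast_one]
  rw [eq_sub_of_add_eq h]
  ring

/-- The average number variance of an ensemble is at least four times the squared coherence of
the mixture. -/
lemma four_mul_norm_sq_le_sum_Vpure {m : ℕ} {q : Fin m → ℝ} {ψ : Fin m → Fin 2 → ℂ}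
    (hq : ∀ i, 0 ≤ q i) (hsum : ∑ i, q i = 1) (hψ : ∀ i, nsq (ψ i) = 1) :
    4 * ‖(∑ i, q i • pureProj (ψ i)) 0 1‖ ^ 2 ≤ ∑ i, q i * Vpure (ψ i) := by
  have hnorm : ‖(∑ i, q i • pureProj (ψ i)) 0 1‖ ≤ ∑ i, q i * ‖pureProj (ψ i) 0 1‖ := by
    rw [Matrix.sum_apply]
    refine (norm_sum_le _ _).trans (Finset.sum_le_sum fun i _ => ?_)
    rw [Matrix.smul_apply, norm_smul, Real.norm_of_nonneg (hq i)]
  have hjensen : (∑ i, q i * ‖pureProj (ψ i) 0 1‖) ^ 2 ≤ ∑ i, q i * ‖pureProj (ψ i) 0 1‖ ^ 2 :=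
    Real.pow_arith_mean_le_arith_mean_pow univ q _ (fun i _ => hq i) hsum
      (fun i _ => norm_nonneg _) 2
  calc 4 * ‖(∑ i, q i • pureProj (ψ i)) 0 1‖ ^ 2
      ≤ 4 * (∑ i, q i * ‖pureProj (ψ i) 0 1‖) ^ 2 := by gcongr
    _ ≤ 4 * ∑ i, q i * ‖pureProj (ψ i) 0 1‖ ^ 2 := by gcongr
    _ = ∑ i, q i * Vpure (ψ i) := by
      rw [Finset.mul_sum]
      refine Finset.sum_congr rfl fun i _ => ?_
      rw [Vpure_eq_of_nsq_eq_one (hψ i)]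
      ring

/-- The projector onto a real qubit vector. -/
lemma pureProj_ofReal (a b : ℝ) :
    pureProj ![(a : ℂ), (b : ℂ)] =
      !![((a ^ 2 : ℝ) : ℂ), ((a * b : ℝ) : ℂ); ((a * b : ℝ) : ℂ), ((b ^ 2 : ℝ) : ℂ)] := by
  ext i j
  fin_cases i <;> fin_cases j <;>
    simp only [pureProj, vecMulVec_apply, Pi.star_apply, Fin.zero_eta, Fin.mk_one, of_apply,
      cons_val_zero, cons_val_one, Complex.star_def, Complex.conj_ofReal] <;>
    push_cast <;> ring

/-- The entries of `rhoAlpha` in Bloch coordinates. -/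
lemma rhoAlpha_eq (α p : ℝ) :
    rhoAlpha α p =
      !![(((1 + (2 * p - 1) * Real.cos α) / 2 : ℝ) : ℂ),
          (((2 * p - 1) * Real.sin α / 2 : ℝ) : ℂ);
        (((2 * p - 1) * Real.sin α / 2 : ℝ) : ℂ),
          (((1 - (2 * p - 1) * Real.cos α) / 2 : ℝ) : ℂ)] := by
  obtain ⟨β, rfl⟩ : ∃ β, α = 2 * β := ⟨α / 2, by ring⟩
  rw [rhoAlpha, phi1, phi2, ← Complex.ofReal_neg, pureProj_ofReal, pureProj_ofReal,
    mul_div_cancel_left₀ β two_ne_zero, Real.sin_two_mul, Real.cos_two_mul]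
  ext i j
  fin_cases i <;> fin_cases j <;>
    simp only [Matrix.add_apply, Matrix.smul_apply, of_apply, cons_val_zero, cons_val_one,
      Fin.zero_eta, Fin.mk_one, Complex.real_smul, ← Complex.ofReal_mul, ← Complex.ofReal_add,
      Complex.ofReal_inj]
  · linear_combination (1 - p) * Real.sin_sq_add_cos_sq β
  · ring
  · ring
  · linear_combination p * Real.sin_sq_add_cos_sq β

/-- If `z² ≤ w²` then `z` is a multiple of `w` by a factor in `[-1, 1]`. -/
lemma exists_abs_le_one_mul_eq {z w : ℝ} (h : z ^ 2 ≤ w ^ 2) : ∃ t : ℝ, |t| ≤ 1 ∧ t * w = z := by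
  refine ⟨z / w, ?_, ?_⟩
  · rw [abs_div]
    exact div_le_one_of_le₀ (sq_le_sq.1 h) (abs_nonneg w)
  · refine div_mul_cancel_of_imp fun hw => ?_
    subst hw
    nlinarith

/-- A real qubit density matrix with Bloch coordinates `(x, z)` is a mixture of two pure states
having the same coherence `x / 2`. -/
lemma exists_decomposition {x z : ℝ} (h : x ^ 2 + z ^ 2 ≤ 1) :
    ∃ (q : Fin 2 → ℝ) (ψ : Fin 2 → Fin 2 → ℂ), (∀ i, 0 ≤ q i) ∧ ∑ i, q i = 1 ∧
      (∀ i, nsq (ψ i) = 1) ∧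
      !![(((1 + z) / 2 : ℝ) : ℂ), ((x / 2 : ℝ) : ℂ); ((x / 2 : ℝ) : ℂ), (((1 - z) / 2 : ℝ) : ℂ)]
        = ∑ i, q i • pureProj (ψ i) ∧
      ∀ i, pureProj (ψ i) 0 1 = ((x / 2 : ℝ) : ℂ) := by
  obtain ⟨θ, hθ⟩ : ∃ θ : ℝ, Real.sin (2 * θ) = x :=
    ⟨Real.arcsin x / 2, by
      rw [mul_div_cancel₀ _ two_ne_zero]; exact Real.sin_arcsin (by nlinarith) (by nlinarith)⟩
  obtain ⟨t, ht, htz⟩ : ∃ t : ℝ, |t| ≤ 1 ∧ t * Real.cos (2 * θ) = z :=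
    exists_abs_le_one_mul_eq (by
      have := Real.sin_sq_add_cos_sq (2 * θ)
      rw [hθ] at this
      linarith)
  obtain ⟨ht₁, ht₂⟩ := abs_le.1 ht
  have hsc := Real.sin_sq_add_cos_sq θ
  rw [Real.sin_two_mul] at hθ
  rw [Real.cos_two_mul] at htz
  refine ⟨![(1 + t) / 2, (1 - t) / 2],
    ![![(Real.cos θ : ℂ), (Real.sin θ : ℂ)], ![(Real.sin θ : ℂ), (Real.cos θ : ℂ)]],
    ?_, ?_, ?_, ?_, ?_⟩
  · intro i
    fin_cases i <;> simp <;> linarith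
  · simp
    ring
  · intro i
    fin_cases i <;> simp [nsq, -Complex.ofReal_cos, -Complex.ofReal_sin]
  · subst hθ htz
    simp only [Fin.sum_univ_two, cons_val_zero, cons_val_one, pureProj_ofReal]
    ext i j
    fin_cases i <;> fin_cases j <;>
      simp only [Matrix.add_apply, Matrix.smul_apply, of_apply, cons_val_zero, cons_val_one,
        Fin.zero_eta, Fin.mk_one, Complex.real_smul, ← Complex.ofReal_mul, ← Complex.ofReal_add,
        Complex.ofReal_inj]
    · linear_combination (-(1 - t) / 2) * hsc
    · ring
    · ring
    · linear_combination (-(1 + t) / 2) * hsc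
  · subst hθ
    intro i
    fin_cases i <;>
      simp only [Fin.zero_eta, Fin.mk_one, cons_val_zero, cons_val_one, pureProj_ofReal, of_apply,
        Complex.ofReal_inj] <;>
      ring

/-- the U(1)-frameness of formation of
`ρ = p|φ₁⟩⟨φ₁| + (1−p)|φ₂⟩⟨φ₂|` is `(1−2p)²·sin²α`. -/
theorem stmt_13 (α p : ℝ) (hp0 : 0 ≤ p) (hp1 : p ≤ 1) :
    convexRoof Vpure (rhoAlpha α p) = (1 - 2 * p) ^ 2 * Real.sin α ^ 2 := by
  have hcoh : 4 * ‖rhoAlpha α p 0 1‖ ^ 2 = (1 - 2 * p) ^ 2 * Real.sin α ^ 2 := by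
    rw [rhoAlpha_eq, of_apply, cons_val_zero, cons_val_one, cons_val_zero, Complex.norm_real,
      Real.norm_eq_abs, sq_abs]
    ring
  refine IsLeast.csInf_eq ⟨?_, ?_⟩
  · have hbloch : ((2 * p - 1) * Real.sin α) ^ 2 + ((2 * p - 1) * Real.cos α) ^ 2 ≤ 1 := by
      nlinarith [Real.sin_sq_add_cos_sq α]
    obtain ⟨q, ψ, hq, hsum, hψ, hρ, hx⟩ := exists_decomposition hbloch
    refine ⟨2, q, ψ, hq, hsum, hψ, (rhoAlpha_eq α p).trans hρ, ?_⟩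
    simp_rw [Vpure_eq_of_nsq_eq_one (hψ _), hx]
    rw [← Finset.sum_mul, hsum, Complex.norm_real, Real.norm_eq_abs, sq_abs]
    ring
  · rintro r ⟨m, q, ψ, hq, hsum, hψ, hρ, rfl⟩
    rw [← hcoh, hρ]
    exact four_mul_norm_sq_le_sum_Vpure hq hsum hψ
end
end
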